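/- Let μ ∈ N be nonzero and let g ∈ GL(n,ℝ). Suppose Ric_μ = c·I + D for some c ∈ ℝ and D ∈ Der(μ), and also Ric_{g.μ} = c′·I + D′ for some c′ ∈ ℝ and D′ ∈ Der(g.μ). Then there exist k ∈ O(n) and t ≠ 0 such that g.μ = t·(k.μ). (Ricci soliton left-invariant metrics on a nilpotent Lie group — equivalently, nilsoliton metrics giving rank-one Einstein solvable extensions — are unique up to isometry and scaling.) -/

import Mathlib

open scoped BigOperators
open Matrix

noncomputable section

/-- vectors in `ℝ^m`. -/
abbrev Vec (m : ℕ) := Fin m → ℝ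

/-- bilinear-map candidates `ℝ^m × ℝ^m → ℝ^m`. -/
abbrev Bil (m : ℕ) := Vec m → Vec m → Vec m

/-- the `i`-th standard basis vector of `ℝ^m`. -/
def bvec (m : ℕ) (i : Fin m) : Vec m := Pi.single i 1

/-- `μ` is a skew-symmetric bilinear map, i.e. an element of `V = Λ²(ℝ^m)* ⊗ ℝ^m`. -/
def IsSkewBil {m : ℕ} (μ : Bil m) : Prop :=
  (∀ Y, IsLinearMap ℝ fun X => μ X Y) ∧ (∀ X, IsLinearMap ℝ (μ X)) ∧ ∀ X Y, μ X Y = -μ Y X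

/-- the Jacobi identity for `μ`. -/
def IsJacobi {m : ℕ} (μ : Bil m) : Prop :=
  ∀ X Y Z, μ (μ X Y) Z + μ (μ Y Z) X + μ (μ Z X) Y = 0

/-- iterated left multiplications `μ(X (k-1), ⋯ μ(X 0, Y))`. -/
def adPow {m : ℕ} (μ : Bil m) (X : ℕ → Vec m) : ℕ → Vec m → Vec m
  | 0, Y => Y
  | k + 1, Y => μ (X k) (adPow μ X k Y)

/-- nilpotency of the bracket `μ`. -/
def IsNilpotentBil {m : ℕ} (μ : Bil m) : Prop :=
  ∃ k : ℕ, ∀ (X : ℕ → Vec m) (Y : Vec m), adPow μ X k Y = 0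

/-- membership in the variety `N` of nilpotent Lie brackets on `ℝ^m`. -/
def NilBracket {m : ℕ} (μ : Bil m) : Prop :=
  IsSkewBil μ ∧ IsJacobi μ ∧ IsNilpotentBil μ

/-- the `GL_m(ℝ)` action `(g.μ)(X,Y) = g μ(g⁻¹X, g⁻¹Y)` on `V`. -/
def mact {m : ℕ} (g : Matrix (Fin m) (Fin m) ℝ) (μ : Bil m) : Bil m :=
  fun X Y => g.mulVec (μ (g⁻¹.mulVec X) (g⁻¹.mulVec Y))

/-- `‖μ‖²` for the natural inner product on `V`. -/
def normSqV {m : ℕ} (μ : Bil m) : ℝ :=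
  ∑ i, ∑ j, ∑ k, (μ (bvec m i) (bvec m j) k) ^ 2

/-- the Ricci operator of `(N_μ, ⟨·,·⟩)`, as a matrix:
`⟨Ric_μ X, Y⟩ = -(1/2) Σ ⟨μ(X,Xᵢ),Xⱼ⟩⟨μ(Y,Xᵢ),Xⱼ⟩ + (1/4) Σ ⟨μ(Xᵢ,Xⱼ),X⟩⟨μ(Xᵢ,Xⱼ),Y⟩`. -/
def RicM {m : ℕ} (μ : Bil m) : Matrix (Fin m) (Fin m) ℝ :=
  Matrix.of fun x y =>
    -(1/2) * (∑ i, ∑ j, μ (bvec m x) (bvec m i) j * μ (bvec m y) (bvec m i) j)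
    + (1/4) * (∑ i, ∑ j, μ (bvec m i) (bvec m j) x * μ (bvec m i) (bvec m j) y)

/-- `D` is a derivation of the bracket `μ`. -/
def IsDerivation {m : ℕ} (μ : Bil m) (D : Matrix (Fin m) (Fin m) ℝ) : Prop :=
  ∀ X Y, D.mulVec (μ X Y) = μ (D.mulVec X) Y + μ X (D.mulVec Y)

/-- the matrix of `ad_μ X : Y ↦ μ(X,Y)`. -/
def adMat {m : ℕ} (μ : Bil m) (X : Vec m) : Matrix (Fin m) (Fin m) ℝ :=
  Matrix.of fun j i => μ X (bvec m i) j

/-- the moment-map value `M_μ = -4 Σᵢ (ad_μ Xᵢ)ᵗ(ad_μ Xᵢ) + 2 Σᵢ (ad_μ Xᵢ)(ad_μ Xᵢ)ᵗ`. -/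
def Mmat {m : ℕ} (μ : Bil m) : Matrix (Fin m) (Fin m) ℝ :=
  (-4 : ℝ) • (∑ i, (adMat μ (bvec m i))ᵀ * adMat μ (bvec m i))
    + (2 : ℝ) • (∑ i, adMat μ (bvec m i) * (adMat μ (bvec m i))ᵀ)

/-- the 2-form `ω(X,Y) = ⟨X, JY⟩`. -/
def sympForm {m : ℕ} (J : Matrix (Fin m) (Fin m) ℝ) (X Y : Vec m) : ℝ :=
  X ⬝ᵥ J.mulVec Y

/-- closedness of a 2-form `ω` with respect to the bracket `μ`:
`ω(μ(X,Y),Z) + ω(μ(Y,Z),X) + ω(μ(Z,X),Y) = 0`. -/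
def IsClosedForm {m : ℕ} (ω : Vec m → Vec m → ℝ) (μ : Bil m) : Prop :=
  ∀ X Y Z, ω (μ X Y) Z + ω (μ Y Z) X + ω (μ Z X) Y = 0

/-- membership in `Sp(n,ℝ)`: invertible and preserving `ω = ⟨·, J·⟩`. -/
def IsSymplMat {m : ℕ} (J g : Matrix (Fin m) (Fin m) ℝ) : Prop :=
  IsUnit g ∧ ∀ X Y, sympForm J (g.mulVec X) (g.mulVec Y) = sympForm J X Y

/-- membership in `GL(n,ℂ) = {g : gJ = Jg}`. -/
def IsCxMat {m : ℕ} (J g : Matrix (Fin m) (Fin m) ℝ) : Prop :=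
  IsUnit g ∧ g * J = J * g

/-- the anti-complexified Ricci operator `Ric^{ac} = (1/2)(Ric + J Ric J)`. -/
def Ricac {m : ℕ} (J : Matrix (Fin m) (Fin m) ℝ) (μ : Bil m) : Matrix (Fin m) (Fin m) ℝ :=
  (1/2 : ℝ) • (RicM μ + J * RicM μ * J)

/-- the complexified Ricci operator `Ric^{c} = (1/2)(Ric − J Ric J)`. -/
def Ricc {m : ℕ} (J : Matrix (Fin m) (Fin m) ℝ) (μ : Bil m) : Matrix (Fin m) (Fin m) ℝ :=
  (1/2 : ℝ) • (RicM μ - J * RicM μ * J)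


section NilsolitonAux

variable {n : ℕ}

lemma ns_bil_apply {μ : Bil n} (h : IsSkewBil μ) (X Y : Vec n) (k : Fin n) :
    μ X Y k = ∑ a, ∑ b, X a * Y b * μ (bvec n a) (bvec n b) k := by
  have hX : X = ∑ a, X a • bvec n a := by
    ext i; simp [bvec, Finset.sum_apply, Pi.single_apply]
  have hY : Y = ∑ a, Y a • bvec n a := by
    ext i; simp [bvec, Finset.sum_apply, Pi.single_apply]
  have h1 : μ X Y = ∑ a, X a • μ (bvec n a) Y := by
    have := map_sum (h.1 Y).mk' (fun a => X a • bvec n a) Finset.univ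
    rw [← hX] at this
    simpa [(h.1 Y).map_smul] using this
  have h2 : ∀ Z, μ Z Y = ∑ b, Y b • μ Z (bvec n b) := by
    intro Z
    have := map_sum (h.2.1 Z).mk' (fun a => Y a • bvec n a) Finset.univ
    rw [← hY] at this
    simpa [(h.2.1 Z).map_smul] using this
  rw [h1]
  simp only [h2, Finset.sum_apply, Pi.smul_apply, smul_eq_mul, Finset.mul_sum]
  refine Finset.sum_congr rfl fun a _ => Finset.sum_congr rfl fun b _ => by ring

lemma ns_ext {μ ν : Bil n} (hμ : IsSkewBil μ) (hν : IsSkewBil ν)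
    (h : ∀ i j k, μ (bvec n i) (bvec n j) k = ν (bvec n i) (bvec n j) k) : μ = ν := by
  funext X Y k
  rw [ns_bil_apply hμ, ns_bil_apply hν]
  simp only [h]

lemma ns_skew {μ : Bil n} (hμ : IsSkewBil μ) (i j k : Fin n) :
    μ (bvec n i) (bvec n j) k = -μ (bvec n j) (bvec n i) k := by
  rw [hμ.2.2]; rfl

lemma ns_mact_skew {μ : Bil n} (hμ : IsSkewBil μ) (g : Matrix (Fin n) (Fin n) ℝ) :
    IsSkewBil (mact g μ) := by
  refine ⟨fun Y => ⟨fun a b => ?_, fun t a => ?_⟩, fun X => ⟨fun a b => ?_, fun t a => ?_⟩,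
    fun X Y => ?_⟩
  · simp only [mact, mulVec_add, (hμ.1 _).map_add]
  · simp only [mact, mulVec_smul, (hμ.1 _).map_smul]
  · simp only [mact, mulVec_add, (hμ.2.1 _).map_add]
  · simp only [mact, mulVec_smul, (hμ.2.1 _).map_smul]
  · simp only [mact]; rw [hμ.2.2, mulVec_neg]

lemma ns_mact_mact (g h : Matrix (Fin n) (Fin n) ℝ) (μ : Bil n) :
    mact g (mact h μ) = mact (g * h) μ := by
  funext X Y
  simp only [mact, mulVec_mulVec, Matrix.mul_inv_rev]

lemma ns_mact_one (μ : Bil n) : mact 1 μ = μ := by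
  funext X Y
  simp [mact]

lemma ns_mact_comp {μ : Bil n} (hμ : IsSkewBil μ) (g : Matrix (Fin n) (Fin n) ℝ)
    (i j k : Fin n) :
    mact g μ (bvec n i) (bvec n j) k =
      ∑ c, ∑ a, ∑ b, g k c * (g⁻¹ a i * g⁻¹ b j * μ (bvec n a) (bvec n b) c) := by
  simp only [mact, mulVec, dotProduct]
  refine Finset.sum_congr rfl fun c _ => ?_
  rw [ns_bil_apply hμ, Finset.mul_sum]
  refine Finset.sum_congr rfl fun a _ => ?_
  rw [Finset.mul_sum]
  refine Finset.sum_congr rfl fun b _ => ?_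
  simp [bvec, Pi.single_apply]

lemma ns_mact_smul_one {μ : Bil n} (hμ : IsSkewBil μ) (s : ℝ) (hs : s ≠ 0) :
    mact (s • (1 : Matrix (Fin n) (Fin n) ℝ)) μ = s⁻¹ • μ := by
  have hinv : (s • (1 : Matrix (Fin n) (Fin n) ℝ))⁻¹ = s⁻¹ • (1 : Matrix (Fin n) (Fin n) ℝ) := by
    apply Matrix.inv_eq_right_inv
    simp [smul_smul, hs]
  funext X Y
  simp only [mact, hinv, smul_mulVec, one_mulVec, (hμ.1 _).map_smul, (hμ.2.1 _).map_smul,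
    smul_smul, Pi.smul_apply]
  congr 1
  field_simp

lemma ns_orth_inv {k : Matrix (Fin n) (Fin n) ℝ} (hk : kᵀ * k = 1) : k⁻¹ = kᵀ :=
  Matrix.inv_eq_left_inv hk

lemma ns_ric_ad {μ : Bil n} (hμ : IsSkewBil μ) :
    RicM μ = (-(1/2) : ℝ) • (∑ i, (adMat μ (bvec n i))ᵀ * adMat μ (bvec n i))
      + (1/4 : ℝ) • (∑ i, adMat μ (bvec n i) * (adMat μ (bvec n i))ᵀ) := by
  ext x y
  simp only [RicM, adMat, Matrix.add_apply, Matrix.smul_apply, Matrix.sum_apply, Matrix.mul_apply,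
    Matrix.of_apply, Matrix.transpose_apply, smul_eq_mul]
  congr 2
  refine Finset.sum_congr rfl fun i _ => Finset.sum_congr rfl fun j _ => ?_
  rw [ns_skew hμ x i, ns_skew hμ y i]; ring

lemma ns_adMat_mact {μ : Bil n} (hμ : IsSkewBil μ) {k : Matrix (Fin n) (Fin n) ℝ}
    (hk : kᵀ * k = 1) (i : Fin n) :
    adMat (mact k μ) (bvec n i) = k * (∑ a, k i a • adMat μ (bvec n a)) * kᵀ := by
  ext x y
  simp only [adMat, Matrix.of_apply]
  rw [ns_mact_comp hμ, ns_orth_inv hk]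
  simp only [Matrix.mul_apply, Matrix.sum_apply, Matrix.smul_apply, Matrix.of_apply,
    Matrix.transpose_apply, smul_eq_mul, Finset.mul_sum, Finset.sum_mul]
  rw [Finset.sum_comm' (t' := Finset.univ) (s' := fun _ => Finset.univ) (by simp)]
  rw [Finset.sum_comm, Finset.sum_comm]
  rw [Finset.sum_congr rfl fun c _ => Finset.sum_comm]
  rw [Finset.sum_comm]
  refine Finset.sum_congr rfl fun c _ => Finset.sum_congr rfl fun a _ =>
    Finset.sum_congr rfl fun b _ => by ring

lemma ns_ric_mact {μ : Bil n} (hμ : IsSkewBil μ) {k : Matrix (Fin n) (Fin n) ℝ}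
    (hk : kᵀ * k = 1) : RicM (mact k μ) = k * RicM μ * kᵀ := by
  have hkk : ∀ a b, ∑ i, k i a * k i b = (1 : Matrix (Fin n) (Fin n) ℝ) a b := by
    intro a b; rw [← hk]; simp [Matrix.mul_apply]
  have key : ∀ F : Fin n → Fin n → Matrix (Fin n) (Fin n) ℝ,
      ∑ i, ∑ a, ∑ b, (k i a * k i b) • F a b = ∑ a, F a a := by
    intro F
    rw [Finset.sum_comm]
    refine Finset.sum_congr rfl fun a _ => ?_
    rw [Finset.sum_comm]
    simp only [← Finset.sum_smul, hkk, Matrix.one_apply]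
    simp
  have hc : ∀ M : Matrix (Fin n) (Fin n) ℝ, kᵀ * (k * M) = M := by
    intro M; rw [← Matrix.mul_assoc, hk, Matrix.one_mul]
  have h1 : ∑ i, (adMat (mact k μ) (bvec n i))ᵀ * adMat (mact k μ) (bvec n i)
      = k * (∑ i, (adMat μ (bvec n i))ᵀ * adMat μ (bvec n i)) * kᵀ := by
    rw [← key (fun a b => (adMat μ (bvec n a))ᵀ * adMat μ (bvec n b)), Finset.mul_sum,
      Finset.sum_mul]
    refine Finset.sum_congr rfl fun i _ => ?_
    rw [ns_adMat_mact hμ hk]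
    simp only [Matrix.transpose_mul, Matrix.transpose_transpose, Matrix.mul_assoc, hc]
    congr 1
    rw [← Matrix.mul_assoc]
    congr 1
    rw [Matrix.transpose_sum, Finset.sum_mul_sum]
    simp only [Matrix.transpose_smul, Matrix.smul_mul, Matrix.mul_smul, smul_smul]
    refine Finset.sum_congr rfl fun a _ => Finset.sum_congr rfl fun b _ => ?_
    rw [mul_comm]
  have h2 : ∑ i, adMat (mact k μ) (bvec n i) * (adMat (mact k μ) (bvec n i))ᵀ
      = k * (∑ i, adMat μ (bvec n i) * (adMat μ (bvec n i))ᵀ) * kᵀ := by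
    rw [← key (fun a b => adMat μ (bvec n a) * (adMat μ (bvec n b))ᵀ), Finset.mul_sum,
      Finset.sum_mul]
    refine Finset.sum_congr rfl fun i _ => ?_
    rw [ns_adMat_mact hμ hk]
    simp only [Matrix.transpose_mul, Matrix.transpose_transpose, Matrix.mul_assoc, hc]
    congr 1
    rw [← Matrix.mul_assoc]
    congr 1
    rw [Matrix.transpose_sum, Finset.sum_mul_sum]
    simp only [Matrix.transpose_smul, Matrix.smul_mul, Matrix.mul_smul, smul_smul]
    refine Finset.sum_congr rfl fun a _ => Finset.sum_congr rfl fun b _ => ?_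
    rw [mul_comm]
  rw [ns_ric_ad (ns_mact_skew hμ k), ns_ric_ad hμ, h1, h2]
  simp only [Matrix.mul_add, Matrix.add_mul, Matrix.mul_smul, Matrix.smul_mul]

lemma ns_ric_diag {μ : Bil n} (hμ : IsSkewBil μ) (d : Fin n → ℝ) :
    ∑ x, d x * RicM μ x x =
      (1/4) * ∑ i, ∑ j, ∑ k, (d k - d i - d j) * (μ (bvec n i) (bvec n j) k) ^ 2 := by
  have e1 : ∀ f : Fin n → Fin n → Fin n → ℝ,
      ∑ i, ∑ j, ∑ k, f i j k = ∑ k, ∑ i, ∑ j, f i j k := by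
    intro f
    rw [Finset.sum_congr rfl fun i _ => Finset.sum_comm, Finset.sum_comm]
  have e2 : ∑ i, ∑ j, ∑ k, d j * (μ (bvec n i) (bvec n j) k) ^ 2 =
      ∑ i, ∑ j, ∑ k, d i * (μ (bvec n i) (bvec n j) k) ^ 2 := by
    rw [Finset.sum_comm]
    refine Finset.sum_congr rfl fun i _ => Finset.sum_congr rfl fun j _ =>
      Finset.sum_congr rfl fun k _ => ?_
    rw [ns_skew hμ j i]; ring
  simp only [sub_mul, Finset.sum_sub_distrib, e2]
  rw [e1 (fun i j k => d k * (μ (bvec n i) (bvec n j) k) ^ 2)]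
  simp only [RicM, Matrix.of_apply, mul_add, Finset.sum_add_distrib, ← Finset.mul_sum]
  have e3 : ∀ x, d x * (-(1/2) * ∑ i, ∑ j, μ (bvec n x) (bvec n i) j * μ (bvec n x) (bvec n i) j)
     = -(1/2) * (d x * ∑ i, ∑ j, μ (bvec n x) (bvec n i) j ^ 2) := by
    intro x; simp only [pow_two]; ring
  have e4 : ∀ x, d x * ((1/4) * ∑ i, ∑ j, μ (bvec n i) (bvec n j) x * μ (bvec n i) (bvec n j) x)
     = (1/4) * (d x * ∑ i, ∑ j, μ (bvec n i) (bvec n j) x ^ 2) := by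
    intro x; simp only [pow_two]; ring
  simp only [e3, e4, ← Finset.mul_sum]
  ring

lemma ns_trace {μ : Bil n} (hμ : IsSkewBil μ) :
    (RicM μ).trace = -(1/4) * normSqV μ := by
  have := ns_ric_diag hμ (fun _ => 1)
  simp only [one_mul] at this
  simp only [Matrix.trace, Matrix.diag_apply, this, normSqV]
  norm_num [Finset.sum_neg_distrib]

lemma ns_ric_symm (μ : Bil n) : (RicM μ)ᵀ = RicM μ := by
  ext x y
  simp only [RicM, Matrix.of_apply, Matrix.transpose_apply]
  congr 2 <;> exact Finset.sum_congr rfl fun i _ => Finset.sum_congr rfl fun j _ => mul_comm _ _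

lemma ns_spectral (A : Matrix (Fin n) (Fin n) ℝ) (hA : Aᵀ = A) :
    ∃ (U : Matrix (Fin n) (Fin n) ℝ) (d : Fin n → ℝ), Antitone d ∧ Uᵀ * U = 1 ∧
      Uᵀ * A * U = diagonal d := by
  have hH : A.IsHermitian := by
    rw [Matrix.IsHermitian, Matrix.conjTranspose_eq_transpose_of_trivial, hA]
  let W : Matrix (Fin n) (Fin n) ℝ := hH.eigenvectorUnitary
  have hW : Wᵀ * W = 1 := by
    have := Unitary.coe_star_mul_self hH.eigenvectorUnitary
    rwa [Matrix.star_eq_conjTranspose, Matrix.conjTranspose_eq_transpose_of_trivial] at this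
  have hD : Wᵀ * A * W = diagonal hH.eigenvalues := by
    have := hH.conjStarAlgAut_star_eigenvectorUnitary
    rw [Unitary.conjStarAlgAut_star_apply, Matrix.star_eq_conjTranspose,
      Matrix.conjTranspose_eq_transpose_of_trivial] at this
    exact this
  let σ := Tuple.sort (fun i => - hH.eigenvalues i)
  refine ⟨W.submatrix id σ, hH.eigenvalues ∘ σ, ?_, ?_, ?_⟩
  · intro i j hij
    have := Tuple.monotone_sort (fun i => - hH.eigenvalues i) hij
    simp only [Function.comp] at this ⊢
    exact neg_le_neg_iff.1 this
  · have : (W.submatrix id σ)ᵀ * W.submatrix id σ = (Wᵀ * W).submatrix σ σ := by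
      ext i j; simp [Matrix.mul_apply]
    rw [this, hW]; simp
  · have : (W.submatrix id σ)ᵀ * A * W.submatrix id σ = (Wᵀ * A * W).submatrix σ σ := by
      ext i j; simp [Matrix.mul_apply]
    rw [this, hD]; simp [Function.comp_def]

lemma ns_qr (g : Matrix (Fin n) (Fin n) ℝ) :
    ∃ Q R : Matrix (Fin n) (Fin n) ℝ, Qᵀ * Q = 1 ∧ g = Q * R ∧ ∀ i j, j < i → R i j = 0 := by
  let f : Fin n → EuclideanSpace ℝ (Fin n) := fun j => WithLp.toLp 2 (fun i => g i j)
  have hcard : Module.finrank ℝ (EuclideanSpace ℝ (Fin n)) = Fintype.card (Fin n) := by simp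
  let b := InnerProductSpace.gramSchmidtOrthonormalBasis hcard f
  let Q : Matrix (Fin n) (Fin n) ℝ := Matrix.of fun i j => b j i
  have hQ : Qᵀ * Q = 1 := by
    ext i j
    have := orthonormal_iff_ite.1 b.orthonormal i j
    rw [Matrix.one_apply, ← this]
    simp [Matrix.mul_apply, Q, PiLp.inner_apply, mul_comm]
  refine ⟨Q, Qᵀ * g, hQ, ?_, ?_⟩
  · rw [← Matrix.mul_assoc, mul_eq_one_comm.1 hQ, Matrix.one_mul]
  · intro i j hij
    have := InnerProductSpace.gramSchmidtOrthonormalBasis_inv_triangular hcard f hij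
    rw [← this]
    simp [Matrix.mul_apply, Q, PiLp.inner_apply, mul_comm, f, b]

/-- Diagonal case of the convexity argument. -/
lemma ns_diag_eq {μ : Bil n} (hμ : IsSkewBil μ) (p : Fin n → ℝ) (hp : ∀ i, 0 < p i)
    (h : ∀ x, RicM (mact (diagonal p) μ) x x = RicM μ x x) : mact (diagonal p) μ = μ := by
  have hinv : (diagonal p)⁻¹ = diagonal (fun i => (p i)⁻¹) := by
    apply Matrix.inv_eq_right_inv
    rw [Matrix.diagonal_mul_diagonal, ← Matrix.diagonal_one]
    congr 1; funext i; exact mul_inv_cancel₀ (hp i).ne'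
  have hν := ns_mact_skew hμ (diagonal p)
  have hcomp : ∀ i j k, mact (diagonal p) μ (bvec n i) (bvec n j) k =
      p k * (p i)⁻¹ * (p j)⁻¹ * μ (bvec n i) (bvec n j) k := by
    intro i j k
    rw [ns_mact_comp hμ, hinv]
    simp [Matrix.diagonal_apply, Finset.sum_ite_eq]
    ring
  set s : Fin n → ℝ := fun i => Real.log (p i) with hs
  have hexp : ∀ i j k, p k * (p i)⁻¹ * (p j)⁻¹ = Real.exp (s k - s i - s j) := by
    intro i j k
    simp only [hs, Real.exp_sub, Real.exp_log (hp _)]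
    field_simp
  have e : ∑ i, ∑ j, ∑ k, (s k - s i - s j) *
      ((mact (diagonal p) μ (bvec n i) (bvec n j) k) ^ 2 - (μ (bvec n i) (bvec n j) k) ^ 2) = 0 := by
    have h1 := ns_ric_diag hν s
    have h2 := ns_ric_diag hμ s
    simp only [h] at h1
    simp only [mul_sub (s _ - s _ - s _), Finset.sum_sub_distrib] 
    linarith
  have hnn : ∀ i j k, 0 ≤ (s k - s i - s j) *
      ((mact (diagonal p) μ (bvec n i) (bvec n j) k) ^ 2 - (μ (bvec n i) (bvec n j) k) ^ 2) := by
    intro i j k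
    rw [hcomp, hexp, mul_pow]
    set x := s k - s i - s j
    have : 0 ≤ x * (Real.exp x ^ 2 - 1) := by
      rw [← Real.exp_nat_mul]
      rcases le_total 0 x with hx | hx
      · apply mul_nonneg hx
        have := Real.one_le_exp (x := (2:ℕ) * x) (by positivity)
        linarith
      · apply mul_nonneg_of_nonpos_of_nonpos hx
        have := Real.exp_le_one_iff (x := (2:ℕ) * x) |>.2 (by push_cast; linarith)
        linarith
    nlinarith [mul_nonneg this (sq_nonneg (μ (bvec n i) (bvec n j) k))]
  have hz : ∀ i j k, (s k - s i - s j) *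
      ((mact (diagonal p) μ (bvec n i) (bvec n j) k) ^ 2 - (μ (bvec n i) (bvec n j) k) ^ 2) = 0 := by
    intro i j k
    have a1 := (Finset.sum_eq_zero_iff_of_nonneg (fun i _ => Finset.sum_nonneg fun j _ =>
      Finset.sum_nonneg fun k _ => hnn i j k)).1 e i (Finset.mem_univ _)
    have a2 := (Finset.sum_eq_zero_iff_of_nonneg (fun j _ =>
      Finset.sum_nonneg fun k _ => hnn i j k)).1 a1 j (Finset.mem_univ _)
    exact (Finset.sum_eq_zero_iff_of_nonneg (fun k _ => hnn i j k)).1 a2 k (Finset.mem_univ _)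
  refine ns_ext hν hμ fun i j k => ?_
  have := hz i j k
  rw [hcomp, hexp] at this ⊢
  rcases mul_eq_zero.1 this with h0 | h0
  · rw [h0]; simp
  · have h3 : (Real.exp (s k - s i - s j) ^ 2 - 1) * μ (bvec n i) (bvec n j) k ^ 2 = 0 := by
      linarith [mul_pow (Real.exp (s k - s i - s j)) (μ (bvec n i) (bvec n j) k) 2]
    rcases mul_eq_zero.1 h3 with h4 | h4
    · have : Real.exp (s k - s i - s j) = 1 := by
        have := Real.exp_pos (s k - s i - s j)
        nlinarith
      rw [this, one_mul]
    · have : μ (bvec n i) (bvec n j) k = 0 := by simpa using h4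
      rw [this, mul_zero]

/-- If `h` commutes with the common Ricci operator, then `h.μ` is in the `O(n)`-orbit. -/
lemma ns_commute {μ : Bil n} (hμ : IsSkewBil μ) (h : Matrix (Fin n) (Fin n) ℝ) (hu : IsUnit h)
    (hR : RicM (mact h μ) = RicM μ) (hc : h * RicM μ = RicM μ * h) :
    ∃ k : Matrix (Fin n) (Fin n) ℝ, kᵀ * k = 1 ∧ mact h μ = mact k μ := by
  set R := RicM μ with hRdef
  have hct : hᵀ * R = R * hᵀ := by
    have := congrArg Matrix.transpose hc
    rw [Matrix.transpose_mul, Matrix.transpose_mul, hRdef, ns_ric_symm] at this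
    exact this.symm
  obtain ⟨W, e, -, hW, hWe⟩ := ns_spectral (hᵀ * h) (by simp)
  have hW' : W * Wᵀ = 1 := mul_eq_one_comm.1 hW
  have hpos : ∀ i, 0 < e i := by
    intro i
    have hi : e i = (h * W).col i ⬝ᵥ (h * W).col i := by
      have := congrFun (congrFun hWe i) i
      rw [Matrix.diagonal_apply_eq] at this
      rw [← this]
      have h2 : Wᵀ * (hᵀ * h) * W = (h * W)ᵀ * (h * W) := by
        simp only [Matrix.transpose_mul, Matrix.mul_assoc]
      rw [h2, Matrix.mul_apply]
      rfl
    have hne : (h * W).col i ≠ 0 := by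
      intro h0
      have hWu : IsUnit W := IsUnit.of_mul_eq_one _ hW'
      have hu2 := (Matrix.isUnit_iff_isUnit_det _).1 (hu.mul hWu)
      apply hu2.ne_zero
      exact Matrix.det_eq_zero_of_column_eq_zero i (fun j => congrFun h0 j)
    rw [hi]
    have h0 : 0 ≤ (h * W).col i ⬝ᵥ (h * W).col i :=
      Finset.sum_nonneg fun j _ => mul_self_nonneg _
    exact lt_of_le_of_ne h0 fun h1 => hne (dotProduct_self_eq_zero.1 h1.symm)
  set p : Fin n → ℝ := fun i => Real.sqrt (e i) with hp
  have hpp : ∀ i, 0 < p i := fun i => Real.sqrt_pos.2 (hpos i)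
  set q : Fin n → ℝ := fun i => (p i)⁻¹ with hq
  have hqp : diagonal q * diagonal p = 1 := by
    rw [Matrix.diagonal_mul_diagonal, ← Matrix.diagonal_one]
    congr 1; funext i; exact inv_mul_cancel₀ (hpp i).ne'
  have hE : diagonal e = diagonal p * diagonal p := by
    rw [Matrix.diagonal_mul_diagonal]
    congr 1; funext i; exact (Real.mul_self_sqrt (hpos i).le).symm
  have hpq : diagonal p * diagonal q = 1 := mul_eq_one_comm.1 hqp
  set K := h * W * diagonal q with hK
  have hKt : Kᵀ = diagonal q * Wᵀ * hᵀ := by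
    rw [hK]; simp [Matrix.transpose_mul, Matrix.mul_assoc]
  have hKK : Kᵀ * K = 1 := by
    rw [hKt, hK]
    calc diagonal q * Wᵀ * hᵀ * (h * W * diagonal q)
        = diagonal q * (Wᵀ * (hᵀ * h) * W) * diagonal q := by simp only [Matrix.mul_assoc]
      _ = (diagonal q * diagonal p) * (diagonal p * diagonal q) := by
          rw [hWe, hE]; simp only [Matrix.mul_assoc]
      _ = 1 := by rw [hqp, hpq, Matrix.one_mul]
  have hKp : h = K * diagonal p * Wᵀ := by
    rw [hK]
    calc h = h * (W * ((diagonal q * diagonal p) * Wᵀ)) := by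
          rw [hqp, Matrix.one_mul, hW', Matrix.mul_one]
      _ = _ := by simp only [Matrix.mul_assoc]
  have hWt : (Wᵀ)ᵀ * Wᵀ = 1 := by rw [Matrix.transpose_transpose, hW']
  have hμ2 := ns_mact_skew hμ Wᵀ
  have hν2 := ns_mact_skew hμ2 (diagonal p)
  have hν : mact h μ = mact K (mact (diagonal p) (mact Wᵀ μ)) := by
    rw [ns_mact_mact, ns_mact_mact, ← hKp]
  have hric : K * RicM (mact (diagonal p) (mact Wᵀ μ)) * Kᵀ = R := by
    rw [← ns_ric_mact hν2 hKK, ← hν, hR]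
  have hric2 : RicM (mact (diagonal p) (mact Wᵀ μ)) = Kᵀ * R * K := by
    rw [← hric]
    calc _ = (Kᵀ * K) * RicM (mact (diagonal p) (mact Wᵀ μ)) * (Kᵀ * K) := by
          rw [hKK, Matrix.one_mul, Matrix.mul_one]
      _ = _ := by simp only [Matrix.mul_assoc]
  have hric3 : RicM (mact Wᵀ μ) = Wᵀ * R * W := by
    rw [ns_ric_mact hμ hWt, Matrix.transpose_transpose]
  have hric4 : RicM (mact (diagonal p) (mact Wᵀ μ)) =
      diagonal q * (RicM (mact Wᵀ μ)) * diagonal p := by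
    rw [hric2, hric3, hKt, hK]
    calc diagonal q * Wᵀ * hᵀ * R * (h * W * diagonal q)
        = diagonal q * Wᵀ * (hᵀ * R) * (h * W * diagonal q) := by simp only [Matrix.mul_assoc]
      _ = diagonal q * Wᵀ * R * (1 * (hᵀ * h)) * W * diagonal q := by
          rw [hct]; simp only [Matrix.mul_assoc, Matrix.one_mul]
      _ = diagonal q * Wᵀ * R * W * (Wᵀ * (hᵀ * h) * W) * diagonal q := by
          rw [← hW']; simp only [Matrix.mul_assoc]
      _ = diagonal q * Wᵀ * R * W * diagonal p * (diagonal p * diagonal q) := by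
          rw [hWe, hE]; simp only [Matrix.mul_assoc]
      _ = _ := by rw [hpq, Matrix.mul_one]; simp only [Matrix.mul_assoc]
  have hfin := ns_diag_eq hμ2 p hpp (by
    intro x
    rw [hric4, Matrix.mul_diagonal, Matrix.diagonal_mul]
    have := (hpp x).ne'
    simp only [hq]
    field_simp)
  refine ⟨K * Wᵀ, ?_, ?_⟩
  · rw [Matrix.transpose_mul]
    calc (Wᵀ)ᵀ * Kᵀ * (K * Wᵀ) = (Wᵀ)ᵀ * (Kᵀ * K) * Wᵀ := by simp only [Matrix.mul_assoc]
      _ = 1 := by rw [hKK, Matrix.mul_one, hWt]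
  · rw [hν, hfin, ns_mact_mact]

/-- Core estimate when the derivation is diagonal and the group element is triangular. -/
lemma ns_core {μ : Bil n} (hμ : IsSkewBil μ) (c : ℝ) (d : Fin n → ℝ)
    (hmin : RicM μ = c • (1 : Matrix (Fin n) (Fin n) ℝ) + diagonal d)
    (hder : IsDerivation μ (diagonal d)) (hd : Antitone d)
    (q : Matrix (Fin n) (Fin n) ℝ) (hq : IsUnit q) (hqt : ∀ i j, j < i → q i j = 0)
    (hN : normSqV (mact q μ) = normSqV μ) :
    (RicM μ * RicM μ).trace ≤ (RicM (mact q μ) * RicM (mact q μ)).trace ∧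
    ((RicM (mact q μ) * RicM (mact q μ)).trace ≤ (RicM μ * RicM μ).trace →
      ∃ k : Matrix (Fin n) (Fin n) ℝ, kᵀ * k = 1 ∧ mact q μ = mact k μ) := by
  have hν := ns_mact_skew hμ q
  have hwt : ∀ i j k, μ (bvec n i) (bvec n j) k ≠ 0 → d k = d i + d j := by
    intro i j k hne
    have := congrFun (hder (bvec n i) (bvec n j)) k
    have hb : ∀ i, (diagonal d).mulVec (bvec n i) = d i • bvec n i := by
      intro i; ext x
      rw [Matrix.mulVec_diagonal]
      by_cases hx : x = i <;> simp [bvec, hx]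
    rw [Matrix.mulVec_diagonal, hb, hb, (hμ.1 _).map_smul, (hμ.2.1 _).map_smul] at this
    simp only [Pi.add_apply, Pi.smul_apply, smul_eq_mul] at this
    apply mul_right_cancel₀ hne
    linarith
  have hqi : ∀ i j, d i < d j → q i j = 0 := by
    intro i j hij
    apply hqt
    by_contra hle
    exact absurd (hd (not_lt.1 hle)) (not_le.2 hij)
  have hqb : q.BlockTriangular (fun i => - d i) := by
    intro i j hij
    exact hqi i j (by simpa using hij)
  have hqinv : ∀ i j, d i < d j → q⁻¹ i j = 0 := by
    intro i j hij
    have := hq.invertible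
    exact blockTriangular_inv_of_blockTriangular hqb (show - d j < - d i by linarith)
  have hνwt : ∀ i j k, mact q μ (bvec n i) (bvec n j) k ≠ 0 → d i + d j ≤ d k := by
    intro i j k hne
    by_contra hlt
    apply hne
    rw [ns_mact_comp hμ]
    refine Finset.sum_eq_zero fun x _ => Finset.sum_eq_zero fun a _ =>
      Finset.sum_eq_zero fun b _ => ?_
    by_contra hz
    have z1 : q k x ≠ 0 := fun h => hz (by simp [h])
    have z2 : q⁻¹ a i ≠ 0 := fun h => hz (by simp [h])
    have z3 : q⁻¹ b j ≠ 0 := fun h => hz (by simp [h])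
    have z4 : μ (bvec n a) (bvec n b) x ≠ 0 := fun h => hz (by simp [h])
    have y1 := not_lt.1 (mt (hqi k x) z1)
    have y2 := not_lt.1 (mt (hqinv a i) z2)
    have y3 := not_lt.1 (mt (hqinv b j) z3)
    have y4 := hwt _ _ _ z4
    apply hlt; linarith
  have hnn : ∀ i j k, 0 ≤ (d k - d i - d j) * (mact q μ (bvec n i) (bvec n j) k) ^ 2 := by
    intro i j k
    by_cases hz : mact q μ (bvec n i) (bvec n j) k = 0
    · simp [hz]
    · have := hνwt _ _ _ hz
      exact mul_nonneg (by linarith) (sq_nonneg _)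
  have hDnn : 0 ≤ ∑ x, d x * RicM (mact q μ) x x := by
    rw [ns_ric_diag hν]
    exact mul_nonneg (by norm_num) (Finset.sum_nonneg fun i _ => Finset.sum_nonneg fun j _ =>
      Finset.sum_nonneg fun k _ => hnn i j k)
  have hD0 : ∑ x, d x * RicM μ x x = 0 := by
    rw [ns_ric_diag hμ]
    have : ∀ i j k, (d k - d i - d j) * (μ (bvec n i) (bvec n j) k) ^ 2 = 0 := by
      intro i j k
      by_cases hz : μ (bvec n i) (bvec n j) k = 0
      · simp [hz]
      · rw [hwt _ _ _ hz]; ring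
    simp [this]
  have htr : ∀ M : Matrix (Fin n) (Fin n) ℝ,
      (M * RicM μ).trace = c * M.trace + ∑ x, d x * M x x := by
    intro M
    rw [hmin, Matrix.mul_add, Matrix.trace_add, Matrix.mul_smul, Matrix.mul_one, Matrix.trace_smul]
    congr 1
    simp [Matrix.trace, Matrix.mul_diagonal, mul_comm]
  have t1 := htr (RicM μ)
  have t2 := htr (RicM (mact q μ))
  rw [ns_trace hμ, hD0] at t1
  rw [ns_trace hν, hN] at t2
  set A := RicM μ with hA
  set B := RicM (mact q μ) with hB
  have hsq : ((B - A) * (B - A)).trace = (B * B).trace + (A * A).trace - 2 * (B * A).trace := by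
    rw [Matrix.sub_mul, Matrix.mul_sub, Matrix.mul_sub, Matrix.trace_sub, Matrix.trace_sub,
      Matrix.trace_sub, Matrix.trace_mul_comm A B]
    ring
  have hsym : (B - A)ᵀ = B - A := by
    rw [Matrix.transpose_sub, hA, hB, ns_ric_symm, ns_ric_symm]
  have hsq2 : ((B - A) * (B - A)).trace = ∑ i, ∑ j, ((B - A) i j) ^ 2 := by
    have hgen : ∀ C : Matrix (Fin n) (Fin n) ℝ, (Cᵀ * C).trace = ∑ i, ∑ j, (C i j) ^ 2 := by
      intro C
      rw [Finset.sum_comm]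
      simp [Matrix.trace, Matrix.mul_apply, pow_two]
    rw [← hgen, hsym]
  have hsq3 : 0 ≤ ((B - A) * (B - A)).trace := by
    rw [hsq2]; positivity
  refine ⟨by linarith, fun hle => ?_⟩
  have hz : ∑ i, ∑ j, ((B - A) i j) ^ 2 = 0 := by linarith
  have hBA : B = A := by
    ext i j
    have a1 := (Finset.sum_eq_zero_iff_of_nonneg (fun i _ => Finset.sum_nonneg fun j _ =>
      sq_nonneg ((B - A) i j))).1 hz i (Finset.mem_univ _)
    have a2 := (Finset.sum_eq_zero_iff_of_nonneg (fun j _ =>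
      sq_nonneg ((B - A) i j))).1 a1 j (Finset.mem_univ _)
    have : (B - A) i j = 0 := by simpa using a2
    rw [Matrix.sub_apply] at this
    linarith
  have hB0 : ∑ x, d x * RicM (mact q μ) x x = 0 := by
    rw [← hB, hBA, hD0]
  have hνeq : ∀ i j k, mact q μ (bvec n i) (bvec n j) k ≠ 0 → d k = d i + d j := by
    intro i j k hne
    rw [ns_ric_diag hν] at hB0
    have e := (mul_eq_zero.1 hB0).resolve_left (by norm_num)
    have a1 := (Finset.sum_eq_zero_iff_of_nonneg (fun i _ => Finset.sum_nonneg fun j _ =>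
      Finset.sum_nonneg fun k _ => hnn i j k)).1 e i (Finset.mem_univ _)
    have a2 := (Finset.sum_eq_zero_iff_of_nonneg (fun j _ =>
      Finset.sum_nonneg fun k _ => hnn i j k)).1 a1 j (Finset.mem_univ _)
    have a3 := (Finset.sum_eq_zero_iff_of_nonneg (fun k _ => hnn i j k)).1 a2 k (Finset.mem_univ _)
    have := (mul_eq_zero.1 a3).resolve_right (by simpa using hne)
    linarith
  -- the block diagonal part of `q`
  set h : Matrix (Fin n) (Fin n) ℝ := Matrix.of fun i j => if d i = d j then q i j else 0 with hh
  set h' : Matrix (Fin n) (Fin n) ℝ := Matrix.of fun i j => if d i = d j then q⁻¹ i j else 0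
    with hh'
  have hqq : q * q⁻¹ = 1 := Matrix.mul_nonsing_inv _ ((Matrix.isUnit_iff_isUnit_det _).1 hq)
  have hhh : h * h' = 1 := by
    ext i j
    rw [← hqq, Matrix.mul_apply]
    by_cases hij : d i = d j
    · rw [Matrix.mul_apply]
      refine Finset.sum_congr rfl fun a _ => ?_
      simp only [hh, hh', Matrix.of_apply]
      by_cases hia : d i = d a
      · rw [if_pos hia, if_pos (hia ▸ hij)]
      · rw [if_neg hia, zero_mul]
        rcases lt_or_gt_of_ne hia with hlt | hlt
        · rw [hqi _ _ hlt, zero_mul]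
        · rw [hqinv a j (hij ▸ hlt), mul_zero]
    · rw [hqq, Matrix.one_apply_ne (fun h => hij (by rw [h]))]
      refine Finset.sum_eq_zero fun a _ => ?_
      simp only [hh, hh', Matrix.of_apply]
      by_cases hia : d i = d a
      · rw [if_neg (fun h => hij (hia.trans h)), mul_zero]
      · rw [if_neg hia, zero_mul]
  have hinv : h⁻¹ = h' := Matrix.inv_eq_right_inv hhh
  have hact : mact q μ = mact h μ := by
    refine ns_ext hν (ns_mact_skew hμ h) fun i j k => ?_
    by_cases hk : d k = d i + d j
    · rw [ns_mact_comp hμ, ns_mact_comp hμ, hinv]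
      refine Finset.sum_congr rfl fun x _ => Finset.sum_congr rfl fun a _ =>
        Finset.sum_congr rfl fun b _ => ?_
      by_cases z4 : μ (bvec n a) (bvec n b) x = 0
      · simp [z4]
      have y4 := hwt _ _ _ z4
      simp only [hh, hh', Matrix.of_apply]
      by_cases z1 : q k x = 0
      · simp [z1]
      by_cases z2 : q⁻¹ a i = 0
      · simp [z2]
      by_cases z3 : q⁻¹ b j = 0
      · simp [z3]
      have y1 := not_lt.1 (mt (hqi k x) z1)
      have y2 := not_lt.1 (mt (hqinv a i) z2)
      have y3 := not_lt.1 (mt (hqinv b j) z3)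
      rw [if_pos (by linarith), if_pos (by linarith), if_pos (by linarith)]
    · have l0 : mact q μ (bvec n i) (bvec n j) k = 0 := by
        by_contra hne; exact hk (hνeq _ _ _ hne)
      rw [l0, ns_mact_comp hμ, hinv]
      symm
      refine Finset.sum_eq_zero fun x _ => Finset.sum_eq_zero fun a _ =>
        Finset.sum_eq_zero fun b _ => ?_
      by_contra hz
      have z1 : h k x ≠ 0 := fun h => hz (by simp [h])
      have z2 : h' a i ≠ 0 := fun h => hz (by simp [h])
      have z3 : h' b j ≠ 0 := fun h => hz (by simp [h])
      have z4 : μ (bvec n a) (bvec n b) x ≠ 0 := fun h => hz (by simp [h])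
      have y1 : d k = d x := by
        by_contra hne; exact z1 (by simp [hh, hne])
      have y2 : d a = d i := by
        by_contra hne; exact z2 (by simp [hh', hne])
      have y3 : d b = d j := by
        by_contra hne; exact z3 (by simp [hh', hne])
      have y4 := hwt _ _ _ z4
      apply hk; linarith
  have hcomm : h * A = A * h := by
    rw [hmin, Matrix.mul_add, Matrix.add_mul]
    congr 1
    · simp
    · ext i j
      rw [Matrix.mul_diagonal, Matrix.diagonal_mul]
      simp only [hh, Matrix.of_apply]
      by_cases hij : d i = d j
      · rw [hij]; ring
      · simp [hij]
  have := ns_commute hμ h (IsUnit.of_mul_eq_one _ hhh) (by rw [← hact, ← hB, hBA]) hcomm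
  rwa [← hact] at this

lemma ns_der_mact {μ : Bil n} {D k : Matrix (Fin n) (Fin n) ℝ} (hD : IsDerivation μ D)
    (hk : kᵀ * k = 1) : IsDerivation (mact k μ) (k * D * kᵀ) := by
  intro X Y
  have hc : ∀ M : Matrix (Fin n) (Fin n) ℝ, kᵀ * (k * M) = M := by
    intro M; rw [← Matrix.mul_assoc, hk, Matrix.one_mul]
  simp only [mact, ns_orth_inv hk, mulVec_mulVec, Matrix.mul_assoc, hk, hc, Matrix.mul_one]
  have := hD (kᵀ.mulVec X) (kᵀ.mulVec Y)
  simp only [mulVec_mulVec] at this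
  rw [← mulVec_mulVec, this, mulVec_add]

lemma ns_main {μ : Bil n} (hμ : IsSkewBil μ) (c : ℝ) (D : Matrix (Fin n) (Fin n) ℝ)
    (hD : IsDerivation μ D)
    (hmin : RicM μ = c • (1 : Matrix (Fin n) (Fin n) ℝ) + D)
    (g : Matrix (Fin n) (Fin n) ℝ) (hg : IsUnit g)
    (hN : normSqV (mact g μ) = normSqV μ) :
    (RicM μ * RicM μ).trace ≤ (RicM (mact g μ) * RicM (mact g μ)).trace ∧
    ((RicM (mact g μ) * RicM (mact g μ)).trace ≤ (RicM μ * RicM μ).trace →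
      ∃ k : Matrix (Fin n) (Fin n) ℝ, kᵀ * k = 1 ∧ mact g μ = mact k μ) := by
  have htr : ∀ {ν : Bil n} (_ : IsSkewBil ν) {k : Matrix (Fin n) (Fin n) ℝ} (_ : kᵀ * k = 1),
      (RicM (mact k ν)).trace = (RicM ν).trace := by
    intro ν hν k hk
    rw [ns_ric_mact hν hk, Matrix.trace_mul_comm, ← Matrix.mul_assoc, hk, Matrix.one_mul]
  have htr2 : ∀ {ν : Bil n} (_ : IsSkewBil ν) {k : Matrix (Fin n) (Fin n) ℝ} (_ : kᵀ * k = 1),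
      (RicM (mact k ν) * RicM (mact k ν)).trace = (RicM ν * RicM ν).trace := by
    intro ν hν k hk
    rw [ns_ric_mact hν hk]
    have : k * RicM ν * kᵀ * (k * RicM ν * kᵀ) = k * (RicM ν * (kᵀ * k) * RicM ν * kᵀ) := by
      simp only [Matrix.mul_assoc]
    rw [this, Matrix.trace_mul_comm, hk, Matrix.mul_one, Matrix.mul_assoc, hk, Matrix.mul_one]
  have hnorm : ∀ {ν : Bil n} (_ : IsSkewBil ν) {k : Matrix (Fin n) (Fin n) ℝ} (_ : kᵀ * k = 1),
      normSqV (mact k ν) = normSqV ν := by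
    intro ν hν k hk
    have := htr hν hk
    rw [ns_trace hν, ns_trace (ns_mact_skew hν k)] at this
    linarith
  have hDs : Dᵀ = D := by
    have : D = RicM μ - c • (1 : Matrix (Fin n) (Fin n) ℝ) := by rw [hmin]; abel
    rw [this, Matrix.transpose_sub, ns_ric_symm]; simp
  obtain ⟨U, d, hd, hU, hUd⟩ := ns_spectral D hDs
  have hU' : U * Uᵀ = 1 := mul_eq_one_comm.1 hU
  have hUt : (Uᵀ)ᵀ * Uᵀ = 1 := by rw [Matrix.transpose_transpose, hU']
  obtain ⟨Q, R, hQ, hQR, hR⟩ := ns_qr (g * U)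
  have hQ' : Q * Qᵀ = 1 := mul_eq_one_comm.1 hQ
  have hQt : (Qᵀ)ᵀ * Qᵀ = 1 := by rw [Matrix.transpose_transpose, hQ']
  have hμ2 := ns_mact_skew hμ Uᵀ
  have hRQ : R = Qᵀ * (g * U) := by rw [hQR, ← Matrix.mul_assoc, hQ, Matrix.one_mul]
  have hRu : IsUnit R := by
    rw [hRQ]
    exact (IsUnit.of_mul_eq_one _ hQ).mul (hg.mul (IsUnit.of_mul_eq_one _ hU'))
  have hν2 : mact R (mact Uᵀ μ) = mact Qᵀ (mact g μ) := by
    rw [ns_mact_mact, ns_mact_mact, hRQ, Matrix.mul_assoc, Matrix.mul_assoc, hU', Matrix.mul_one]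
  have hν := ns_mact_skew hμ g
  have hmin2 : RicM (mact Uᵀ μ) = c • (1 : Matrix (Fin n) (Fin n) ℝ) + diagonal d := by
    rw [ns_ric_mact hμ hUt, hmin, Matrix.transpose_transpose, ← hUd, Matrix.mul_add,
      Matrix.add_mul]
    congr 1
    simp [hU]
  have hder2 : IsDerivation (mact Uᵀ μ) (diagonal d) := by
    have := ns_der_mact hD hUt
    rwa [Matrix.transpose_transpose, hUd] at this
  have core := ns_core hμ2 c d hmin2 hder2 hd R hRu hR (by
    rw [hν2, hnorm hν hQt, hN, hnorm hμ hUt])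
  rw [hν2, htr2 hμ hUt, htr2 hν hQt] at core
  refine ⟨core.1, fun hle => ?_⟩
  obtain ⟨k, hk, hk2⟩ := core.2 hle
  refine ⟨Q * (k * Uᵀ), ?_, ?_⟩
  · calc (Q * (k * Uᵀ))ᵀ * (Q * (k * Uᵀ)) = (Uᵀ)ᵀ * (kᵀ * ((Qᵀ * Q) * (k * Uᵀ))) := by
          simp only [Matrix.transpose_mul, Matrix.mul_assoc]
      _ = (Uᵀ)ᵀ * ((kᵀ * k) * Uᵀ) := by rw [hQ, Matrix.one_mul, Matrix.mul_assoc]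
      _ = 1 := by rw [hk, Matrix.one_mul, hUt]
  · rw [← ns_mact_mact, ← ns_mact_mact, ← hk2, ns_mact_mact, hQ', ns_mact_one]

end NilsolitonAux

/-- Ricci soliton (nilsoliton) left-invariant metrics on a nilpotent Lie group are
unique up to isometry and scaling. -/
theorem nilsoliton_unique (n : ℕ) (hn : 1 ≤ n)
    (μ : Bil n) (hμ : NilBracket μ) (hμ0 : μ ≠ 0)
    (g : Matrix (Fin n) (Fin n) ℝ) (hg : IsUnit g)
    (c : ℝ) (D : Matrix (Fin n) (Fin n) ℝ) (hD : IsDerivation μ D)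
    (hmin : RicM μ = c • (1 : Matrix (Fin n) (Fin n) ℝ) + D)
    (c' : ℝ) (D' : Matrix (Fin n) (Fin n) ℝ) (hD' : IsDerivation (mact g μ) D')
    (hmin' : RicM (mact g μ) = c' • (1 : Matrix (Fin n) (Fin n) ℝ) + D') :
    ∃ (k : Matrix (Fin n) (Fin n) ℝ) (t : ℝ), t ≠ 0 ∧
      kᵀ * k = 1 ∧ mact g μ = t • mact k μ := by
  have hs := hμ.1
  have hν := ns_mact_skew hs g
  have hgi : g⁻¹ * g = 1 := Matrix.nonsing_inv_mul _ ((Matrix.isUnit_iff_isUnit_det _).1 hg)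
  have hback : mact g⁻¹ (mact g μ) = μ := by rw [ns_mact_mact, hgi, ns_mact_one]
  have hnpos : ∀ {ν : Bil n}, IsSkewBil ν → ν ≠ 0 → 0 < normSqV ν := by
    intro ν hν h0
    have hnn : 0 ≤ normSqV ν := by unfold normSqV; positivity
    refine lt_of_le_of_ne hnn fun he => h0 ?_
    funext X Y k
    rw [ns_bil_apply hν]
    refine Finset.sum_eq_zero fun i _ => Finset.sum_eq_zero fun j _ => ?_
    have a1 := (Finset.sum_eq_zero_iff_of_nonneg (fun i _ => Finset.sum_nonneg fun j _ =>
      Finset.sum_nonneg fun k _ => sq_nonneg (ν (bvec n i) (bvec n j) k))).1 he.symm i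
      (Finset.mem_univ _)
    have a2 := (Finset.sum_eq_zero_iff_of_nonneg (fun j _ =>
      Finset.sum_nonneg fun k _ => sq_nonneg (ν (bvec n i) (bvec n j) k))).1 a1 j
      (Finset.mem_univ _)
    have a3 := (Finset.sum_eq_zero_iff_of_nonneg (fun k _ =>
      sq_nonneg (ν (bvec n i) (bvec n j) k))).1 a2 k (Finset.mem_univ _)
    have : ν (bvec n i) (bvec n j) k = 0 := by simpa using a3
    rw [this, mul_zero]
  have hν0 : mact g μ ≠ 0 := by
    intro h0
    apply hμ0
    rw [← hback, h0]
    funext X Y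
    simp [mact]
  have h1 := hnpos hs hμ0
  have h2 := hnpos hν hν0
  set r := Real.sqrt (normSqV μ / normSqV (mact g μ)) with hr
  have hrpos : 0 < r := Real.sqrt_pos.2 (div_pos h1 h2)
  have hr2 : r ^ 2 = normSqV μ / normSqV (mact g μ) := Real.sq_sqrt (div_pos h1 h2).le
  -- the rescaled bracket
  have hsc : mact (r⁻¹ • (1 : Matrix (Fin n) (Fin n) ℝ) * g) μ = r • mact g μ := by
    rw [← ns_mact_mact, ns_mact_smul_one hν _ (inv_ne_zero hrpos.ne'), inv_inv]
  have hu : IsUnit (r⁻¹ • (1 : Matrix (Fin n) (Fin n) ℝ) * g) := by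
    refine IsUnit.mul (IsUnit.of_mul_eq_one (r • (1 : Matrix (Fin n) (Fin n) ℝ)) ?_) hg
    simp [smul_smul, hrpos.ne']
  set G := r⁻¹ • (1 : Matrix (Fin n) (Fin n) ℝ) * g with hG
  have hνG := ns_mact_skew hs G
  have hric : RicM (mact G μ) = (r ^ 2) • RicM (mact g μ) := by
    rw [hsc]
    ext x y
    simp only [RicM, Matrix.of_apply, Matrix.smul_apply, Pi.smul_apply, smul_eq_mul]
    have e : ∀ a b : ℝ, r * a * (r * b) = r ^ 2 * (a * b) := fun a b => by ring
    simp only [e, ← Finset.mul_sum]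
    ring
  have hnorm : normSqV (mact G μ) = normSqV μ := by
    have : normSqV (mact G μ) = r ^ 2 * normSqV (mact g μ) := by
      rw [hsc]
      simp only [normSqV, Pi.smul_apply, smul_eq_mul, mul_pow, Finset.mul_sum]
    rw [this, hr2]
    field_simp
  have hder : IsDerivation (mact G μ) ((r ^ 2) • D') := by
    intro X Y
    have := hD' X Y
    rw [hsc]
    simp only [Pi.smul_apply, smul_mulVec, mulVec_smul, (hν.1 _).map_smul, (hν.2.1 _).map_smul,
      this, smul_add]
  have hminG : RicM (mact G μ) = (r ^ 2 * c') • (1 : Matrix (Fin n) (Fin n) ℝ) + (r ^ 2) • D' := by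
    rw [hric, hmin', smul_add, smul_smul]
  have hGi : G⁻¹ * G = 1 := Matrix.nonsing_inv_mul _ ((Matrix.isUnit_iff_isUnit_det _).1 hu)
  have hGi' : G * G⁻¹ = 1 := mul_eq_one_comm.1 hGi
  have hbackG : mact G⁻¹ (mact G μ) = μ := by rw [ns_mact_mact, hGi, ns_mact_one]
  have m1 := ns_main hs c D hD hmin G hu hnorm
  have m2 := ns_main hνG _ _ hder hminG G⁻¹ (IsUnit.of_mul_eq_one _ hGi)
    (by rw [hbackG, hnorm])
  rw [hbackG] at m2
  obtain ⟨k, hk, hk2⟩ := m1.2 m2.1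
  refine ⟨k, r⁻¹, inv_ne_zero hrpos.ne', hk, ?_⟩
  rw [← hk2, hsc, smul_smul, inv_mul_cancel₀ hrpos.ne', one_smul]
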